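/- Every orthomodular lattice L can be embedded into a Boolean saturated orthomodular lattice: there exists a Boolean saturated orthomodular lattice M and an injective map e : L → M preserving ∧, ∨, ¬, 0 and 1. -/

import Mathlib

universe u

/-- An orthomodular structure on a bounded lattice: an involutive De Morgan
orthocomplement satisfying the orthomodular law. -/
class OrthoStructure (α : Type u) [Lattice α] [BoundedOrder α] where
  ocompl : α → α
  ocompl_ocompl : ∀ x : α, ocompl (ocompl x) = x
  ocompl_sup : ∀ x y : α, ocompl (x ⊔ y) = ocompl x ⊓ ocompl y
  inf_ocompl : ∀ x : α, x ⊓ ocompl x = ⊥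
  orthomodular : ∀ x y : α, x ⊔ (ocompl x ⊓ (x ⊔ y)) = x ⊔ y

open OrthoStructure

variable {α : Type u} [Lattice α] [BoundedOrder α] [OrthoStructure α]

/-- Both distributive identities for the ordered triple `(x, y, w)`. -/
def DistribTriple (x y w : α) : Prop :=
  (x ⊔ y) ⊓ w = (x ⊓ w) ⊔ (y ⊓ w) ∧ (x ⊓ y) ⊔ w = (x ⊔ w) ⊓ (y ⊔ w)

/-- `z` is central: both distributive identities hold for every permutation of `(a, b, z)`. -/
def IsCentral (z : α) : Prop :=
  ∀ a b : α, DistribTriple a b z ∧ DistribTriple a z b ∧ DistribTriple b a z ∧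
    DistribTriple b z a ∧ DistribTriple z a b ∧ DistribTriple z b a

/-- The center `Z(α)` of an orthomodular lattice. -/
def center (α : Type u) [Lattice α] [BoundedOrder α] [OrthoStructure α] : Set α :=
  {z | IsCentral z}

/-- The horizontal sum of `β` with the six-element orthomodular lattice `MO₂`, whose four
middle elements are the `atom p`; the complement of `atom (i, j)` is `atom (i, !j)`. -/
inductive HorizontalSum (β : Type u) : Type u
  | base : β → HorizontalSum β
  | atom : Bool × Bool → HorizontalSum β

namespace HorizontalSum

section Order

variable {β : Type u} [Lattice β] [BoundedOrder β]

/-- The order on the horizontal sum. -/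
def le : HorizontalSum β → HorizontalSum β → Prop
  | base x, base y => x ≤ y
  | base x, atom _ => x = ⊥
  | atom _, base y => y = ⊤
  | atom p, atom q => p = q

open Classical in
/-- The join in the horizontal sum. -/
noncomputable def sup : HorizontalSum β → HorizontalSum β → HorizontalSum β
  | base x, base y => base (x ⊔ y)
  | base x, atom q => if x = ⊥ then atom q else base ⊤
  | atom p, base y => if y = ⊥ then atom p else base ⊤
  | atom p, atom q => if p = q then atom p else base ⊤

open Classical in
/-- The meet in the horizontal sum. -/
noncomputable def inf : HorizontalSum β → HorizontalSum β → HorizontalSum β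
  | base x, base y => base (x ⊓ y)
  | base x, atom q => if x = ⊤ then atom q else base ⊥
  | atom p, base y => if y = ⊤ then atom p else base ⊥
  | atom p, atom q => if p = q then atom p else base ⊥

noncomputable instance [Nontrivial β] : Lattice (HorizontalSum β) where
  le := le
  le_refl := by rintro (x | p) <;> simp [le]
  le_trans := by
    have h : (⊤ : β) ≠ ⊥ := top_ne_bot
    rintro (x | p) (y | q) (z | r) <;> simp only [le] <;> intro h₁ h₂ <;> subst_vars <;>
      simp_all
    exact h₁.trans h₂
  le_antisymm := by
    have h : (⊤ : β) ≠ ⊥ := top_ne_bot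
    rintro (x | p) (y | q) <;> simp only [le] <;> intro h₁ h₂ <;> subst_vars <;> simp_all
    exact le_antisymm h₁ h₂
  sup := sup
  inf := inf
  le_sup_left := by
    rintro (x | p) (y | q) <;> simp only [sup] <;> (try split_ifs) <;> simp_all [le]
  le_sup_right := by
    rintro (x | p) (y | q) <;> simp only [sup] <;> (try split_ifs) <;> simp_all [le]
  sup_le := by
    rintro (x | p) (y | q) (z | r) <;> simp only [sup] <;> (try split_ifs) <;> simp_all [le]
    rintro rfl
    exact Ne.symm ‹_›
  inf_le_left := by
    rintro (x | p) (y | q) <;> simp only [inf] <;> (try split_ifs) <;> simp_all [le]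
  inf_le_right := by
    rintro (x | p) (y | q) <;> simp only [inf] <;> (try split_ifs) <;> simp_all [le]
  le_inf := by
    rintro (x | p) (y | q) (z | r) <;> simp only [inf] <;> (try split_ifs) <;> simp_all [le]

variable [Nontrivial β]

instance : BoundedOrder (HorizontalSum β) where
  top := base ⊤
  bot := base ⊥
  le_top := by rintro (x | p) <;> simp [LE.le, le]
  bot_le := by rintro (x | p) <;> simp [LE.le, le]

theorem bot_def : (⊥ : HorizontalSum β) = base ⊥ := rfl

theorem top_def : (⊤ : HorizontalSum β) = base ⊤ := rfl

theorem base_sup_atom {x : β} (hx : x ≠ ⊥) (p : Bool × Bool) : base x ⊔ atom p = ⊤ :=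
  if_neg hx

theorem base_inf_atom {x : β} (hx : x ≠ ⊤) (p : Bool × Bool) : base x ⊓ atom p = ⊥ :=
  if_neg hx

theorem atom_sup_atom {p q : Bool × Bool} (h : p ≠ q) :
    (atom p ⊔ atom q : HorizontalSum β) = ⊤ :=
  if_neg h

theorem atom_inf_atom {p q : Bool × Bool} (h : p ≠ q) :
    (atom p ⊓ atom q : HorizontalSum β) = ⊥ :=
  if_neg h

end Order

end HorizontalSum

section Center

variable {β : Type u} [Lattice β] [BoundedOrder β]

theorem isCentral_bot : IsCentral (⊥ : β) := by
  intro a b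
  simp [DistribTriple]

theorem isCentral_top : IsCentral (⊤ : β) := by
  intro a b
  simp [DistribTriple]

/-- If only `⊥` and `⊤` are central, every element has a least central element above it. -/
theorem exists_isLeast_central_of_center_trivial
    (h : ∀ z : β, IsCentral z → z = ⊥ ∨ z = ⊤) (p : β) :
    ∃ d : β, IsLeast {z : β | IsCentral z ∧ p ≤ z} d := by
  by_cases hp : p = ⊥
  · exact ⟨⊥, ⟨isCentral_bot, hp.le⟩, fun _ _ => bot_le⟩
  · refine ⟨⊤, ⟨isCentral_top, le_top⟩, ?_⟩
    rintro z ⟨hz, hpz⟩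
    rcases h z hz with rfl | rfl
    · exact absurd (le_bot_iff.mp hpz) hp
    · exact le_rfl

end Center

theorem ocompl_bot : ocompl (⊥ : α) = ⊤ := by
  have h := ocompl_sup (ocompl (⊤ : α)) ⊥
  rw [sup_bot_eq, ocompl_ocompl] at h
  exact top_le_iff.mp (h ▸ inf_le_right)

theorem ocompl_top : ocompl (⊤ : α) = ⊥ := by
  rw [← ocompl_bot, ocompl_ocompl]

theorem ocompl_eq_top {x : α} : ocompl x = ⊤ ↔ x = ⊥ :=
  ⟨fun h => by rw [← ocompl_ocompl x, h, ocompl_top], fun h => h ▸ ocompl_bot⟩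

theorem ocompl_eq_bot {x : α} : ocompl x = ⊥ ↔ x = ⊤ :=
  ⟨fun h => by rw [← ocompl_ocompl x, h, ocompl_bot], fun h => h ▸ ocompl_top⟩

theorem sup_ocompl (x : α) : x ⊔ ocompl x = ⊤ := by
  rw [← ocompl_eq_bot, ocompl_sup, inf_ocompl]

theorem IsCentral.inf_sup_ocompl_inf {z : α} (hz : IsCentral z) (a : α) :
    (z ⊓ a) ⊔ (ocompl z ⊓ a) = a := by
  rw [← (hz (ocompl z) a).2.2.2.2.1.1, sup_ocompl, top_inf_eq]

namespace HorizontalSum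

variable [Nontrivial α]

instance : OrthoStructure (HorizontalSum α) where
  ocompl
    | base x => base (ocompl x)
    | atom p => atom (p.1, !p.2)
  ocompl_ocompl := by rintro (x | p) <;> simp [ocompl_ocompl]
  ocompl_sup := by
    rintro (x | p) (y | q)
    · exact congrArg base (ocompl_sup x y)
    · by_cases hx : x = ⊥
      · subst hx
        simp [← bot_def, ← top_def, ocompl_bot]
      · rw [base_sup_atom hx, base_inf_atom (mt ocompl_eq_top.mp hx)]
        exact congrArg base ocompl_top
    · by_cases hy : y = ⊥
      · subst hy
        simp [← bot_def, ← top_def, ocompl_bot]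
      · rw [sup_comm, base_sup_atom hy, inf_comm, base_inf_atom (mt ocompl_eq_top.mp hy)]
        exact congrArg base ocompl_top
    · by_cases hpq : p = q
      · subst hpq
        simp
      · rw [atom_sup_atom hpq, atom_inf_atom (by simpa [Prod.ext_iff] using hpq)]
        exact congrArg base ocompl_top
  inf_ocompl := by
    rintro (x | p)
    · exact congrArg base (inf_ocompl x)
    · exact atom_inf_atom (by simp [Prod.ext_iff])
  orthomodular := by
    rintro (x | p) (y | q)
    · exact congrArg base (orthomodular x y)
    · by_cases hx : x = ⊥
      · subst hx
        simp [← bot_def, ← top_def, ocompl_bot]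
      · simp only [base_sup_atom hx, inf_top_eq]
        exact congrArg base (sup_ocompl x)
    · have hp : p ≠ (p.1, !p.2) := by simp [Prod.ext_iff]
      by_cases hy : y = ⊥
      · subst hy
        simp [← bot_def]
      · simp only [sup_comm _ (base y), base_sup_atom hy, inf_top_eq, atom_sup_atom hp]
    · have hp : p ≠ (p.1, !p.2) := by simp [Prod.ext_iff]
      by_cases hpq : p = q
      · subst hpq
        simp
      · simp only [atom_sup_atom hpq, inf_top_eq, atom_sup_atom hp]

theorem ocompl_base (x : α) : ocompl (base x) = base (ocompl x) := rfl

theorem ocompl_atom (p : Bool × Bool) :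
    ocompl (atom p : HorizontalSum α) = atom (p.1, !p.2) := rfl

theorem eq_bot_or_eq_top_of_isCentral (z : HorizontalSum α) (hz : IsCentral z) :
    z = ⊥ ∨ z = ⊤ := by
  rcases z with x | p
  · by_contra! h
    have hx : x ≠ ⊤ := fun hx => h.2 (congrArg base hx)
    have hx' : ocompl x ≠ ⊤ := fun hx' => h.1 (congrArg base (ocompl_eq_top.mp hx'))
    have key := hz.inf_sup_ocompl_inf (atom (true, true))
    rw [ocompl_base, base_inf_atom hx, base_inf_atom hx', sup_bot_eq, bot_def] at key
    cases key
  · have key := hz.inf_sup_ocompl_inf (atom (!p.1, p.2))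
    rw [ocompl_atom, atom_inf_atom (by simp [Prod.ext_iff]),
      atom_inf_atom (by simp [Prod.ext_iff]), sup_bot_eq, bot_def] at key
    cases key

end HorizontalSum

/-- Every orthomodular lattice embeds into a Boolean saturated orthomodular
lattice: there is an orthomodular lattice `M` in which every element has a
smallest central element above it, together with an injective map `e : α → M`
preserving `⊓`, `⊔`, the orthocomplement, `⊥` and `⊤`. -/
theorem exists_booleanSaturated_embedding :
    ∃ (M : Type u) (_ : Lattice M) (_ : BoundedOrder M) (_ : OrthoStructure M)
      (e : α → M),
      (∀ p : M, ∃ d : M, IsLeast {z : M | IsCentral z ∧ p ≤ z} d) ∧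
      Function.Injective e ∧
      (∀ x y : α, e (x ⊓ y) = e x ⊓ e y) ∧
      (∀ x y : α, e (x ⊔ y) = e x ⊔ e y) ∧
      (∀ x : α, e (ocompl x) = ocompl (e x)) ∧
      e ⊥ = ⊥ ∧ e ⊤ = ⊤ := by
  rcases subsingleton_or_nontrivial α with _ | _
  · exact ⟨α, inferInstance, inferInstance, inferInstance, id,
      exists_isLeast_central_of_center_trivial fun _ _ => Or.inl (Subsingleton.elim _ _),
      Function.injective_id, fun _ _ => rfl, fun _ _ => rfl, fun _ => rfl, rfl, rfl⟩
  · exact ⟨HorizontalSum α, inferInstance, inferInstance, inferInstance, HorizontalSum.base,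
      exists_isLeast_central_of_center_trivial HorizontalSum.eq_bot_or_eq_top_of_isCentral,
      fun _ _ => HorizontalSum.base.inj, fun _ _ => rfl, fun _ _ => rfl, fun _ => rfl, rfl, rfl⟩
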